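/- arXiv:1401.3128 — 3 statements merged into one kernel-verified Lean document; each statement's English description precedes it below -/
import Mathlib

section
/- For n ≥ 4, the Coxeter polynomial of the tree E_n (the path on n−1 vertices with an extra vertex attached to the third vertex) satisfies (t−1)·cox_{E_n}(t) = t^{n-2}(t^3 − t − 1) + t^3 + t^2 − 1. -/
open Matrix Polynomial

/-- The Coxeter polynomial of a graph given by its adjacency matrix `A`
(indexed by a linearly ordered finite vertex set), defined as the
characteristic polynomial of the Coxeter matrix `-Ǧ·Ǧ⁻ᵀ`, where `Ǧ` is the
upper triangular Gram matrix of the graph. -/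
noncomputable def coxPoly {V : Type} [Fintype V] [LinearOrder V]
    (A : Matrix V V ℤ) : Polynomial ℤ :=
  let G : Matrix V V ℤ := Matrix.of fun i j => if i = j then 1 else if i < j then -A i j else 0
  (-(G * Gᵀ⁻¹)).charpoly
/-- Adjacency matrix of the diagram `E_n`: the path `0 - 1 - 3 - 4 - ⋯ - (n-1)`
together with an extra vertex `2` joined to `3`. -/
def eAdj (n : ℕ) : Matrix (Fin n) (Fin n) ℤ :=
  Matrix.of fun i j =>
    if (i.1 + 1 = j.1 ∧ i.1 ≠ 1 ∧ i.1 ≠ 2) ∨ (j.1 + 1 = i.1 ∧ j.1 ≠ 1 ∧ j.1 ≠ 2) ∨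
       (i.1 = 1 ∧ j.1 = 3) ∨ (j.1 = 1 ∧ i.1 = 3) ∨
       (i.1 = 2 ∧ j.1 = 3) ∨ (j.1 = 2 ∧ i.1 = 3) then 1 else 0

/-- Laplace expansion along the last row and column for a matrix whose last row and column
vanish except in their final two entries. -/
theorem Matrix.det_of_last_row_col {R : Type*} [CommRing R] (f : ℕ → ℕ → R) (n : ℕ)
    (hrow : ∀ j < n, f (n + 1) j = 0) (hcol : ∀ i < n, f i (n + 1) = 0) :
    (Matrix.of fun i j : Fin (n + 2) => f i j).det =
      f (n + 1) (n + 1) * (Matrix.of fun i j : Fin (n + 1) => f i j).det -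
        f n (n + 1) * f (n + 1) n * (Matrix.of fun i j : Fin n => f i j).det := by
  have hminor : ((Matrix.of fun i j : Fin (n + 2) => f i j).submatrix (Fin.last (n + 1)).succAbove
      (Fin.last n).castSucc.succAbove).det =
        f n (n + 1) * (Matrix.of fun i j : Fin n => f i j).det := by
    have hlast : (Fin.last n).castSucc.succAbove (Fin.last n) = Fin.last (n + 1) := by
      simp [Fin.succAbove]
    have hcast (j : Fin n) : (Fin.last n).castSucc.succAbove j.castSucc = j.castSucc.castSucc := by
      simp [Fin.succAbove, Fin.lt_def]
    have hsub : ((Matrix.of fun i j : Fin (n + 2) => f i j).submatrix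
        (Fin.last (n + 1)).succAbove (Fin.last n).castSucc.succAbove).submatrix
          (Fin.last n).succAbove (Fin.last n).succAbove =
        Matrix.of fun i j : Fin n => f i j := by
      ext i j
      simp [hcast]
    rw [Matrix.det_succ_column _ (Fin.last n), Fin.sum_univ_castSucc,
      Finset.sum_eq_zero (fun i _ => by simp [hlast, hcol]), hsub]
    simp [hlast, ← two_mul]
  have hsub : (Matrix.of fun i j : Fin (n + 2) => f i j).submatrix
      (Fin.last (n + 1)).succAbove (Fin.last (n + 1)).succAbove =
        Matrix.of fun i j : Fin (n + 1) => f i j := by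
    ext i j
    simp
  rw [Matrix.det_succ_row _ (Fin.last (n + 1)), Fin.sum_univ_castSucc, Fin.sum_univ_castSucc,
    Finset.sum_eq_zero (fun i _ => by simp [hrow]), hminor, hsub]
  have hsign : (-1 : R) ^ (n * 2) = 1 := Even.neg_one_pow (even_two.mul_left n)
  simp [← two_mul, pow_add, pow_mul]
  linear_combination (-(f (n + 1) n * f n (n + 1) *
    (Matrix.of fun i j : Fin n => f i j).det)) * hsign

theorem coxPoly_eq_det {V : Type} [Fintype V] [LinearOrder V] (A : Matrix V V ℤ) :
    coxPoly A = (Matrix.of fun i j : V => if i = j then (X : ℤ[X]) + 1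
      else if i < j then -C (A i j) else -X * C (A j i)).det := by
  let G : Matrix V V ℤ := Matrix.of fun i j => if i = j then 1 else if i < j then -A i j else 0
  change (-(G * Gᵀ⁻¹)).charpoly = _
  have hG : G.det = 1 := by
    rw [Matrix.det_of_isUpperTriangular]
    · simp [G]
    · intro i j hij
      have hij : j < i := hij
      simp [G, hij.ne', hij.not_gt]
  have hGT : (Gᵀ.map (C : ℤ →+* ℤ[X])).det = 1 := by
    have h := RingHom.map_det (C : ℤ →+* ℤ[X]) Gᵀ
    rw [Matrix.det_transpose, hG, map_one] at h
    exact h.symm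
  have hinv : Gᵀ⁻¹ * Gᵀ = 1 := Matrix.nonsing_inv_mul _ (by simp [hG])
  conv_lhs => rw [Matrix.charpoly, ← mul_one (Matrix.det _), ← hGT, ← Matrix.det_mul]
  congr 1
  have hmul : (-(G * Gᵀ⁻¹)).charmatrix * Gᵀ.map (C : ℤ →+* ℤ[X]) =
      (X : ℤ[X]) • Gᵀ.map (C : ℤ →+* ℤ[X]) + G.map (C : ℤ →+* ℤ[X]) := by
    have h : (-(G * Gᵀ⁻¹)).map (C : ℤ →+* ℤ[X]) * Gᵀ.map (C : ℤ →+* ℤ[X]) =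
        -G.map (C : ℤ →+* ℤ[X]) := by
      rw [← Matrix.map_mul, Matrix.neg_mul, Matrix.mul_assoc, hinv, Matrix.mul_one]
      ext i j : 1
      simp
    have hdef : (-(G * Gᵀ⁻¹)).charmatrix =
      Matrix.scalar V (X : ℤ[X]) - (-(G * Gᵀ⁻¹)).map (C : ℤ →+* ℤ[X]) := rfl
    rw [hdef, Matrix.sub_mul, h, sub_neg_eq_add, Matrix.scalar_apply,
      ← Matrix.smul_eq_diagonal_mul]
  rw [hmul]
  ext i j : 1
  rcases lt_trichotomy i j with h | rfl | h
  · simp [G, h, h.ne, h.ne', h.not_gt]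
  · simp [G]
  · simp [G, h, h.ne, h.ne', h.not_gt]

/-- The entries of `X • Gᵀ + G`, where `G` is the Gram matrix of `E_n`; they do not depend
on `n`. -/
noncomputable def eEntry (i j : ℕ) : ℤ[X] :=
  if i = j then X + 1
  else if (i + 1 = j ∧ i ≠ 1 ∧ i ≠ 2) ∨ (i = 1 ∧ j = 3) ∨ (i = 2 ∧ j = 3) then -1
  else if (j + 1 = i ∧ j ≠ 1 ∧ j ≠ 2) ∨ (j = 1 ∧ i = 3) ∨ (j = 2 ∧ i = 3) then -X
  else 0

theorem coxPoly_eAdj_eq_det (n : ℕ) :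
    coxPoly (eAdj n) = (Matrix.of fun i j : Fin n => eEntry i j).det := by
  rw [coxPoly_eq_det]
  congr 1
  ext i j : 1
  simp only [Matrix.of_apply, eAdj, eEntry, Fin.ext_iff, Fin.lt_def]
  split_ifs <;> first | omega | simp

theorem coxPoly_eAdj_add_two (n : ℕ) (hn : 3 ≤ n) :
    coxPoly (eAdj (n + 2)) = (X + 1) * coxPoly (eAdj (n + 1)) - X * coxPoly (eAdj n) := by
  simp only [coxPoly_eAdj_eq_det]
  rw [Matrix.det_of_last_row_col eEntry n]
  · have h₁ : eEntry n (n + 1) = -1 := by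
      unfold eEntry; split_ifs <;> first | omega | rfl
    have h₂ : eEntry (n + 1) n = -X := by
      unfold eEntry; split_ifs <;> first | omega | rfl
    have h₃ : eEntry (n + 1) (n + 1) = X + 1 := by simp [eEntry]
    rw [h₁, h₂, h₃]
    ring
  all_goals
    intro j hj
    unfold eEntry; split_ifs <;> first | omega | rfl

theorem coxPoly_eAdj_three : coxPoly (eAdj 3) = (X + 1) * (X ^ 2 + X + 1) := by
  rw [coxPoly_eAdj_eq_det, Matrix.det_fin_three]
  simp [eEntry]
  ring

theorem coxPoly_eAdj_four : coxPoly (eAdj 4) = X ^ 4 + X ^ 3 + X ^ 2 + X + 1 := by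
  rw [coxPoly_eAdj_eq_det, Matrix.det_succ_row_zero]
  simp [Fin.sum_univ_succ, Matrix.det_fin_three, eEntry, Fin.succAbove]
  ring

theorem coxPoly_eAdj_add_three (n : ℕ) :
    ((X : ℤ[X]) - 1) * coxPoly (eAdj (n + 3)) =
      X ^ (n + 1) * (X ^ 3 - X - 1) + X ^ 3 + X ^ 2 - 1 := by
  induction n using Nat.twoStepInduction with
  | zero => rw [coxPoly_eAdj_three]; ring
  | one => rw [coxPoly_eAdj_four]; ring
  | more n ih₀ ih₁ =>
    rw [coxPoly_eAdj_add_two (n + 3) (by omega)]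
    linear_combination (X + 1) * ih₁ - X * ih₀

/-- `(t-1)·cox_{E_n}(t) = t^{n-2}(t³ - t - 1) + t³ + t² - 1` for `n ≥ 4`. -/
theorem coxPoly_eAdj (n : ℕ) (hn : 4 ≤ n) :
    ((X : Polynomial ℤ) - 1) * coxPoly (eAdj n) =
      X ^ (n - 2) * (X ^ 3 - X - 1) + X ^ 3 + X ^ 2 - 1 := by
  obtain ⟨m, rfl⟩ := Nat.exists_eq_add_of_le' (show 3 ≤ n by omega)
  exact coxPoly_eAdj_add_three m
end

section
/- Let S⁰_{p,q,r} be the star tree obtained by joining a new central vertex to one endpoint of each of the paths A_p, A_q, A_r. Then (t−1)·cox_{S⁰_{p,q,r}}(t) = t^{r+2}·F(t) − F*(t), where F(t) = t^{p+q} − cox_{A_{p-1}}(t)·cox_{A_{q-1}}(t) and F*(t) = t^{p+q}·F(1/t) is the reciprocal polynomial of F. -/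
open Matrix Polynomial

/-- `cox_{A_m}(t) = tᵐ + ⋯ + t + 1`, the Coxeter polynomial of the path `A_m`
(with `cox_{A_0} = 1`). -/
noncomputable def coxA (m : ℕ) : Polynomial ℤ := ∑ i ∈ Finset.range (m + 1), X ^ i

/-- Adjacency matrix of the star tree `S⁰_{p,q,r}`, the join of the paths
`A_p`, `A_q`, `A_r` at one endpoint of each: vertex `0` is the new central
vertex, joined to the endpoints `1`, `p+1`, `p+q+1` of the three arms
`1,…,p`, `p+1,…,p+q` and `p+q+1,…,p+q+r`. -/
def starAdj (p q r : ℕ) : Matrix (Fin (p + q + r + 1)) (Fin (p + q + r + 1)) ℤ :=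
  Matrix.of fun i j =>
    if (i.1 = 0 ∧ (j.1 = 1 ∨ j.1 = p + 1 ∨ j.1 = p + q + 1)) ∨
       (j.1 = 0 ∧ (i.1 = 1 ∨ i.1 = p + 1 ∨ i.1 = p + q + 1)) ∨
       (i.1 + 1 = j.1 ∧ i.1 ≠ 0 ∧ i.1 ≠ p ∧ i.1 ≠ p + q) ∨
       (j.1 + 1 = i.1 ∧ j.1 ≠ 0 ∧ j.1 ≠ p ∧ j.1 ≠ p + q) then 1 else 0

/-- The entries of `t·Ǧᵀ + Ǧ` for the star tree, as a function of natural number indices. -/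
noncomputable def starEntry (p q : ℕ) (i j : ℕ) : ℤ[X] :=
  if i = j then X + 1
  else if i = 0 ∧ (j = 1 ∨ j = p + 1 ∨ j = p + q + 1) then -1
  else if j = 0 ∧ (i = 1 ∨ i = p + 1 ∨ i = p + q + 1) then -X
  else if i + 1 = j ∧ i ≠ 0 ∧ i ≠ p ∧ i ≠ p + q then -1
  else if j + 1 = i ∧ j ≠ 0 ∧ j ≠ p ∧ j ≠ p + q then -X
  else 0

theorem coxPoly_starAdj_eq_det (p q r : ℕ) :
    coxPoly (starAdj p q r) =
      (Matrix.of fun i j : Fin (p + q + r + 1) => starEntry p q i j).det := by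
  rw [coxPoly_eq_det]
  congr 1
  ext1 i j
  obtain ⟨i, hi⟩ := i
  obtain ⟨j, hj⟩ := j
  simp only [of_apply, starAdj, starEntry, Fin.mk.injEq, Fin.mk_lt_mk]
  rcases lt_trichotomy i j with h | h | h
  · have h1 : ¬ (j = 0) := by omega
    have h2 : ¬ (j + 1 = i) := by omega
    simp only [h.ne, h, h1, h2, if_true, if_false, false_and, false_or, or_false]
    split_ifs <;> simp_all
  · simp [h]
  · have h1 : ¬ (i = 0) := by omega
    have h2 : ¬ (i + 1 = j) := by omega
    simp only [h.ne', h.not_gt, h1, h2, if_false, false_and, false_or, or_false]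
    split_ifs <;> simp_all

section Tridiagonal

variable {R : Type*} [CommRing R]

/-- Expansion of a tridiagonal determinant along its first row and column. -/
theorem det_tridiagonal_succ_succ (f : ℕ → ℕ → R)
    (hf : ∀ i j, i + 1 < j ∨ j + 1 < i → f i j = 0) (k n : ℕ) :
    (Matrix.of fun i j : Fin (n + 2) => f (k + i) (k + j)).det =
      f k k * (Matrix.of fun i j : Fin (n + 1) => f (k + 1 + i) (k + 1 + j)).det -
      f k (k + 1) * f (k + 1) k *
        (Matrix.of fun i j : Fin n => f (k + 2 + i) (k + 2 + j)).det := by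
  rw [det_succ_row_zero, Fin.sum_univ_succ, Fin.sum_univ_succ, Finset.sum_eq_zero]
  · have hminor : ((Matrix.of fun i j : Fin (n + 2) => f (k + i) (k + j)).submatrix Fin.succ
        (Fin.succ (0 : Fin (n + 1))).succAbove).det = f (k + 1) k *
        (Matrix.of fun i j : Fin n => f (k + 2 + i) (k + 2 + j)).det := by
      rw [det_succ_column_zero, Fin.sum_univ_succ, Finset.sum_eq_zero]
      · simp only [Fin.val_zero, pow_zero, one_mul, add_zero, submatrix_apply, of_apply,
          Fin.succ_succAbove_zero, Fin.val_succ, zero_add]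
        congr 2
        ext1 i j
        simp only [submatrix_apply, of_apply, Fin.zero_succAbove, Fin.val_succ,
          Fin.succ_succAbove_succ]
        congr 1 <;> omega
      · intro i _
        simp only [submatrix_apply, of_apply, Fin.succ_succAbove_zero, Fin.val_succ,
          Fin.val_zero]
        rw [hf _ _ (Or.inr (by omega))]
        simp
    rw [hminor]
    have hfirst : ((Matrix.of fun i j : Fin (n + 2) => f (k + i) (k + j)).submatrix Fin.succ
        (Fin.succAbove (0 : Fin (n + 2)))) =
        Matrix.of fun i j : Fin (n + 1) => f (k + 1 + i) (k + 1 + j) := by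
      ext1 i j
      simp only [submatrix_apply, of_apply, Fin.zero_succAbove, Fin.val_succ]
      congr 1 <;> omega
    rw [hfirst]
    simp only [Fin.val_zero, Fin.val_succ, of_apply, add_zero, zero_add]
    ring
  · intro j _
    simp only [of_apply, Fin.val_succ, Fin.val_zero]
    rw [hf _ _ (Or.inl (by omega))]
    simp

/-- A row of a tridiagonal matrix applied to a vector. -/
theorem sum_tridiagonal_row (f : ℕ → ℕ → R)
    (hf : ∀ i j, i + 1 < j ∨ j + 1 < i → f i j = 0) (v : ℕ → R) {k n : ℕ} (hk : k < n) :
    ∑ j ∈ Finset.range n, f k j * v j =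
      (if k = 0 then 0 else f k (k - 1) * v (k - 1)) + f k k * v k +
        (if k + 1 < n then f k (k + 1) * v (k + 1) else 0) := by
  have hsplit : ∀ j ∈ Finset.range n, f k j * v j =
      (if j = k - 1 then (if k = 0 then 0 else f k (k - 1) * v (k - 1)) else 0) +
      (if j = k then f k k * v k else 0) +
      (if j = k + 1 then f k (k + 1) * v (k + 1) else 0) := by
    intro j _
    by_cases h : k + 1 < j ∨ j + 1 < k
    · rw [hf _ _ h, if_neg (by omega), if_neg (by omega), if_neg (by omega)]
      ring
    · obtain h | h | h : j = k ∨ j = k + 1 ∨ (k = j + 1) := by omega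
      · subst h
        rcases j with _ | j <;> simp
      · subst h
        simp [show k + 1 ≠ k - 1 by omega]
      · subst h
        simp [show j ≠ j + 1 + 1 by omega]
  rw [Finset.sum_congr rfl hsplit, Finset.sum_add_distrib, Finset.sum_add_distrib,
    Finset.sum_ite_eq', Finset.sum_ite_eq', Finset.sum_ite_eq']
  simp only [Finset.mem_range]
  rw [if_pos (show k - 1 < n by omega), if_pos hk]

end Tridiagonal

/-- `[n] = 1 + t + ⋯ + t^{n-1}`. -/
noncomputable def geom (n : ℕ) : ℤ[X] := ∑ i ∈ Finset.range n, X ^ i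

theorem geom_zero : geom 0 = 0 := by simp [geom]

theorem geom_succ (n : ℕ) : geom (n + 1) = X * geom n + 1 := geom_sum_succ

theorem X_pow_eq_geom (n : ℕ) : (X : ℤ[X]) ^ n = 1 + (X - 1) * geom n := by
  rw [geom, mul_geom_sum]
  ring

theorem geom_succ_ne_zero (n : ℕ) : geom (n + 1) ≠ 0 := by
  intro h
  have := congrArg (coeff · 0) h
  simp [geom_succ] at this

theorem coxA_pred {n : ℕ} (hn : 1 ≤ n) : coxA (n - 1) = geom n := by
  rw [coxA, Nat.sub_add_cancel hn, geom]

theorem natDegree_geom_le (n : ℕ) : (geom n).natDegree ≤ n :=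
  natDegree_sum_le_of_forall_le _ _ fun i hi => by
    rw [natDegree_X_pow]
    exact (Finset.mem_range.mp hi).le

theorem reflect_geom (n : ℕ) : reflect n (geom n) = X * geom n := by
  induction n with
  | zero => simp [geom_zero]
  | succ n ih =>
    have h : geom (n + 1) = geom n * X + 1 := by rw [geom_succ]; ring
    have h1 : reflect 1 (X : ℤ[X]) = 1 := by simp
    have h2 : reflect (n + 1) (1 : ℤ[X]) = X ^ (n + 1) := by simp
    rw [h, reflect_add, reflect_mul _ _ (natDegree_geom_le n) natDegree_X_le, ih, h1, h2,
      X_pow_eq_geom, geom_succ]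
    ring

/-- Entries of `t·Ǧᵀ + Ǧ` restricted to the three arms of the star. -/
noncomputable def armEntry (p q : ℕ) (i j : ℕ) : ℤ[X] := starEntry p q (i + 1) (j + 1)

theorem armEntry_self (p q i : ℕ) : armEntry p q i i = X + 1 := by
  simp [armEntry, starEntry]

theorem armEntry_succ_right (p q i : ℕ) :
    armEntry p q i (i + 1) = if i + 1 = p ∨ i + 1 = p + q then 0 else -1 := by
  grind [armEntry, starEntry]

theorem armEntry_succ_left (p q i : ℕ) :
    armEntry p q (i + 1) i = if i + 1 = p ∨ i + 1 = p + q then 0 else -X := by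
  grind [armEntry, starEntry]

theorem armEntry_eq_zero (p q : ℕ) (i j : ℕ) (h : i + 1 < j ∨ j + 1 < i) :
    armEntry p q i j = 0 := by
  grind [armEntry, starEntry]

/-- Splitting off a path of length `a` from the determinant of the arms. -/
theorem det_armEntry_add (p q b : ℕ) : ∀ a k : ℕ,
    (∀ i, i + 1 < a → k + i + 1 ≠ p ∧ k + i + 1 ≠ p + q) →
    (b ≠ 0 → k + a = p ∨ k + a = p + q) →
    (Matrix.of fun i j : Fin (a + b) => armEntry p q (k + i) (k + j)).det =
      geom (a + 1) * (Matrix.of fun i j : Fin b => armEntry p q (k + a + i) (k + a + j)).det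
  | 0, k, _, _ => by
    have e : 0 + b = b := zero_add b
    rw [geom_succ, geom_zero, mul_zero, zero_add (1 : ℤ[X]), one_mul]
    rw [← det_submatrix_equiv_self (finCongr e)]
    rfl
  | 1, k, _, hb => by
    rcases b with _ | b
    · simp [armEntry_self, geom_succ, geom_zero]
    · have e : b + 2 = 1 + (b + 1) := by omega
      rw [← det_submatrix_equiv_self (finCongr e)]
      have := det_tridiagonal_succ_succ _ (armEntry_eq_zero p q) k b
      refine Eq.trans this ?_
      rw [armEntry_succ_right, if_pos (hb (by omega)), armEntry_self]
      simp only [geom_succ, geom_zero]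
      ring
  | a + 2, k, ha, hb => by
    have e : a + b + 2 = a + 2 + b := by omega
    have e1 : a + 1 + b = a + b + 1 := by omega
    rw [← det_submatrix_equiv_self (finCongr e)]
    refine Eq.trans (det_tridiagonal_succ_succ _ (armEntry_eq_zero p q) k (a + b)) ?_
    have h0 := ha 0 (by omega)
    rw [armEntry_succ_right, armEntry_succ_left, armEntry_self,
      if_neg (by simpa using h0), if_neg (by simpa using h0), ← det_submatrix_equiv_self (finCongr e1)]
    have r1 := det_armEntry_add p q b (a + 1) (k + 1)
      (fun i hi => by have := ha (i + 1) (by omega); omega)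
      (fun h => by have := hb h; omega)
    have r2 := det_armEntry_add p q b a (k + 2)
      (fun i hi => by have := ha (i + 2) (by omega); omega)
      (fun h => by have := hb h; omega)
    rw [show k + 1 + (a + 1) = k + (a + 2) by ring] at r1
    rw [show k + 2 + a = k + (a + 2) by ring] at r2
    rw [r2]
    refine (congrArg (fun z => (X + 1) * z - _) r1).trans ?_
    simp only [geom_succ]
    ring

theorem det_armEntry (p q r : ℕ) (hq : 1 ≤ q) :
    (Matrix.of fun i j : Fin (p + q + r) => armEntry p q i j).det =
      geom (p + 1) * geom (q + 1) * geom (r + 1) := by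
  have e : p + (q + (r + 0)) = p + q + r := by omega
  rw [← det_submatrix_equiv_self (finCongr e)]
  have h1 := det_armEntry_add p q (q + (r + 0)) p 0 (fun i hi => by omega) (fun _ => by omega)
  have h2 := det_armEntry_add p q (r + 0) q (0 + p) (fun i hi => by omega) (fun _ => by omega)
  have h3 := det_armEntry_add p q 0 r (0 + p + q) (fun i hi => by omega) (fun h => by omega)
  rw [h2, h3] at h1
  simp only [zero_add, det_isEmpty] at h1
  refine Eq.trans (Eq.trans ?_ h1) (by ring)
  rfl

/-- The vector on a path of length `n` mapped to `[n+1]` times the first basis vector. -/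
noncomputable def pathVec (n k : ℕ) : ℤ[X] := X ^ k * geom (n - k)

theorem pathVec_self (n : ℕ) : pathVec n n = 0 := by simp [pathVec, geom_zero]

theorem pathVec_zero (n : ℕ) : pathVec n 0 = geom n := by simp [pathVec]

theorem pathVec_first {n : ℕ} (hn : 1 ≤ n) :
    (X + 1) * pathVec n 0 - pathVec n 1 = geom (n + 1) := by
  obtain ⟨m, rfl⟩ := Nat.exists_eq_add_of_le' hn
  simp only [pathVec, Nat.add_sub_cancel, Nat.sub_zero, geom_succ]
  ring

theorem pathVec_step {n k : ℕ} (hk : k + 1 < n) :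
    -X * pathVec n k + (X + 1) * pathVec n (k + 1) - pathVec n (k + 2) = 0 := by
  obtain ⟨m, rfl⟩ := Nat.exists_eq_add_of_lt hk
  simp only [pathVec, show k + 1 + m + 1 - k = m + 1 + 1 by omega,
    show k + 1 + m + 1 - (k + 1) = m + 1 by omega,
    show k + 1 + m + 1 - (k + 2) = m by omega, geom_succ]
  ring

/-- The arm part of a vector mapped by `t·Ǧᵀ + Ǧ` to a multiple of the central basis vector. -/
noncomputable def armVec (p q r k : ℕ) : ℤ[X] :=
  if k < p then X * geom (q + 1) * geom (r + 1) * pathVec p k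
  else if k < p + q then X * geom (p + 1) * geom (r + 1) * pathVec q (k - p)
  else X * geom (p + 1) * geom (q + 1) * pathVec r (k - (p + q))

theorem armVec_left {p q r k : ℕ} (hk : k < p) :
    armVec p q r k = X * geom (q + 1) * geom (r + 1) * pathVec p k := if_pos hk

theorem armVec_middle {p q r k : ℕ} (hk : k < q) :
    armVec p q r (p + k) = X * geom (p + 1) * geom (r + 1) * pathVec q k := by
  rw [armVec, if_neg (by omega), if_pos (by omega), Nat.add_sub_cancel_left]

theorem armVec_right (p q r k : ℕ) :
    armVec p q r (p + q + k) = X * geom (p + 1) * geom (q + 1) * pathVec r k := by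
  rw [armVec, if_neg (by omega), if_neg (by omega), Nat.add_sub_cancel_left]

/-- One arm of the star: rows of the arm matrix applied to a vector which is a multiple
of `pathVec` on that arm. -/
theorem sum_armEntry_of_arm {p q N s n : ℕ} (v : ℕ → ℤ[X]) (c : ℤ[X])
    (hv : ∀ k < n, v (s + k) = c * pathVec n k) (hs : s = 0 ∨ s = p ∨ s = p + q)
    (he : s + n = p ∨ s + n = p + q ∨ s + n = N) (hN : s + n ≤ N)
    (hin : ∀ k, 0 < k → k < n → s + k ≠ p ∧ s + k ≠ p + q) {k : ℕ} (hk : k < n) :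
    ∑ j ∈ Finset.range N, armEntry p q (s + k) j * v j =
      if k = 0 then c * geom (n + 1) else 0 := by
  rw [sum_tridiagonal_row _ (armEntry_eq_zero p q) v (by omega : s + k < N), armEntry_self,
    hv k hk]
  have hright : (if s + k + 1 < N then armEntry p q (s + k) (s + k + 1) * v (s + k + 1) else 0) =
      -(c * pathVec n (k + 1)) := by
    by_cases h : k + 1 < n
    · have := hin (k + 1) (by omega) h
      rw [if_pos (by omega), armEntry_succ_right, if_neg (by omega), add_assoc, hv _ h]
      ring
    · obtain rfl : n = k + 1 := by omega
      rw [pathVec_self, armEntry_succ_right, mul_zero, neg_zero]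
      split_ifs
      · rw [zero_mul]
      · omega
      · rfl
  rw [hright]
  rcases k with _ | k
  · have hleft : (if s + 0 = 0 then 0 else armEntry p q (s + 0) (s + 0 - 1) * v (s + 0 - 1)) =
        0 := by
      rcases s with _ | s
      · simp
      · rw [if_neg (by omega), add_zero, Nat.add_sub_cancel, armEntry_succ_left,
          if_pos (by omega), zero_mul]
    rw [hleft, if_pos rfl, ← pathVec_first (by omega)]
    ring
  · have := hin (k + 1) (by omega) hk
    rw [if_neg (by omega), if_neg (by omega), show s + (k + 1) - 1 = s + k by omega,
      ← add_assoc, armEntry_succ_left, if_neg (by omega), hv k (by omega)]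
    linear_combination c * pathVec_step hk

theorem starEntry_succ_zero (p q k : ℕ) :
    starEntry p q (k + 1) 0 = if k = 0 ∨ k = p ∨ k = p + q then -X else 0 := by
  grind [starEntry]

theorem starEntry_zero_succ {p q : ℕ} (hp : 1 ≤ p) (hq : 1 ≤ q) (k : ℕ) :
    starEntry p q 0 (k + 1) = (if k = 0 then -1 else 0) + (if k = p then -1 else 0) +
      (if k = p + q then -1 else 0) := by
  grind [starEntry]

theorem sum_starEntry_succ {p q r k : ℕ} (hp : 1 ≤ p) (hq : 1 ≤ q) (hk : k < p + q + r) :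
    ∑ j ∈ Finset.range (p + q + r), armEntry p q k j * armVec p q r j +
      starEntry p q (k + 1) 0 * (geom (p + 1) * geom (q + 1) * geom (r + 1)) = 0 := by
  rw [starEntry_succ_zero]
  obtain h | ⟨l, rfl, h⟩ | ⟨l, rfl, h⟩ :
      k < p ∨ (∃ l, k = p + l ∧ l < q) ∨ (∃ l, k = p + q + l ∧ l < r) := by
    by_cases h1 : k < p
    · exact Or.inl h1
    · by_cases h2 : k < p + q
      · exact Or.inr (Or.inl ⟨k - p, by omega, by omega⟩)
      · exact Or.inr (Or.inr ⟨k - (p + q), by omega, by omega⟩)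
  · have := sum_armEntry_of_arm (p := p) (q := q) (N := p + q + r) (s := 0) (n := p)
      (armVec p q r) _ (fun k hk => by rw [zero_add]; exact armVec_left hk) (by omega)
      (by omega) (by omega) (fun k _ _ => by omega) h
    rw [zero_add] at this
    rw [this]
    split_ifs <;> first | omega | ring
  · rw [sum_armEntry_of_arm (s := p) (n := q)
      (armVec p q r) _ (fun k hk => armVec_middle hk) (by omega)
      (by omega) (by omega) (fun k _ _ => by omega) h]
    split_ifs <;> first | omega | ring
  · rw [sum_armEntry_of_arm (s := p + q) (n := r)
      (armVec p q r) _ (fun k _ => armVec_right p q r k) (by omega)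
      (by omega) (by omega) (fun k _ _ => by omega) h]
    split_ifs <;> first | omega | ring

theorem sum_starEntry_zero {p q r : ℕ} (hp : 1 ≤ p) (hq : 1 ≤ q) (hr : 1 ≤ r) :
    ∑ j ∈ Finset.range (p + q + r), starEntry p q 0 (j + 1) * armVec p q r j =
      -(X * geom (q + 1) * geom (r + 1) * geom p + X * geom (p + 1) * geom (r + 1) * geom q +
        X * geom (p + 1) * geom (q + 1) * geom r) := by
  have h0 : armVec p q r 0 = _ := armVec_left (by omega)
  have h1 : armVec p q r p = _ := armVec_middle (k := 0) (by omega)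
  have h2 : armVec p q r (p + q) = _ := armVec_right p q r 0
  simp only [starEntry_zero_succ hp hq, add_mul, ite_mul, zero_mul, Finset.sum_add_distrib,
    Finset.sum_ite_eq', Finset.mem_range]
  rw [if_pos (by omega), if_pos (by omega), if_pos (by omega), h0, h1, h2]
  simp only [pathVec_zero]
  ring

/-- The determinant of a matrix with a vector sent to a multiple of the first basis vector. -/
theorem det_mul_apply_zero {R : Type*} [CommRing R] {n : ℕ}
    (M : Matrix (Fin (n + 1)) (Fin (n + 1)) R) (w : Fin (n + 1) → R) (d : R)
    (h : M *ᵥ w = Pi.single 0 d) :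
    M.det * w 0 = (M.submatrix Fin.succ Fin.succ).det * d := by
  have h1 := congrArg (fun x => (M.adjugate *ᵥ x) 0) h
  simp only [mulVec_mulVec, adjugate_mul, smul_mulVec, one_mulVec, Pi.smul_apply, smul_eq_mul,
    mulVec_single] at h1
  rw [h1]
  simp [adjugate_fin_succ_eq_det_submatrix]

theorem coxPoly_starAdj_eq_geom {p q r : ℕ} (hp : 1 ≤ p) (hq : 1 ≤ q) (hr : 1 ≤ r) :
    coxPoly (starAdj p q r) = (X + 1) * (geom (p + 1) * geom (q + 1) * geom (r + 1)) -
      (X * geom (q + 1) * geom (r + 1) * geom p + X * geom (p + 1) * geom (r + 1) * geom q +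
        X * geom (p + 1) * geom (q + 1) * geom r) := by
  rw [coxPoly_starAdj_eq_det]
  set w : Fin (p + q + r + 1) → ℤ[X] :=
    Fin.cons (geom (p + 1) * geom (q + 1) * geom (r + 1)) fun k => armVec p q r k with hw
  have key := det_mul_apply_zero
    (Matrix.of fun i j : Fin (p + q + r + 1) => starEntry p q i j) w
    ((X + 1) * (geom (p + 1) * geom (q + 1) * geom (r + 1)) -
      (X * geom (q + 1) * geom (r + 1) * geom p + X * geom (p + 1) * geom (r + 1) * geom q +
        X * geom (p + 1) * geom (q + 1) * geom r)) ?_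
  · have hminor : ((Matrix.of fun i j : Fin (p + q + r + 1) => starEntry p q i j).submatrix
        Fin.succ Fin.succ).det = geom (p + 1) * geom (q + 1) * geom (r + 1) := by
      rw [← det_armEntry p q r hq]
      rfl
    rw [hminor, mul_comm] at key
    refine mul_left_cancel₀ ?_ key
    exact mul_ne_zero (mul_ne_zero (geom_succ_ne_zero p) (geom_succ_ne_zero q))
      (geom_succ_ne_zero r)
  · ext1 i
    rw [mulVec, dotProduct, Fin.sum_univ_succ]
    refine Fin.cases ?_ (fun k => ?_) i
    · simp only [of_apply, hw, Fin.cons_zero, Fin.cons_succ, Fin.val_zero, Fin.val_succ,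
        Pi.single_eq_same]
      rw [Fin.sum_univ_eq_sum_range (fun j => starEntry p q 0 (j + 1) * armVec p q r j),
        sum_starEntry_zero hp hq hr]
      simp only [starEntry, if_true]
      ring
    · simp only [of_apply, hw, Fin.cons_zero, Fin.cons_succ, Fin.val_zero, Fin.val_succ]
      rw [Pi.single_eq_of_ne (Fin.succ_ne_zero k),
        Fin.sum_univ_eq_sum_range (fun j => starEntry p q (k + 1) (j + 1) * armVec p q r j),
        add_comm]
      exact sum_starEntry_succ hp hq k.isLt

/-- `(t−1)·cox_{S⁰_{p,q,r}}(t) = t^{r+2}·F(t) − F*(t)`, where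
`F(t) = t^{p+q} − cox_{A_{p-1}}(t)·cox_{A_{q-1}}(t)` and `F*` is its reciprocal
`F*(t) = t^{p+q}·F(1/t)`. -/
theorem coxPoly_starAdj (p q r : ℕ) (hp : 1 ≤ p) (hq : 1 ≤ q) (hr : 1 ≤ r) :
    ((X : Polynomial ℤ) - 1) * coxPoly (starAdj p q r) =
      X ^ (r + 2) * (X ^ (p + q) - coxA (p - 1) * coxA (q - 1)) -
        Polynomial.reflect (p + q) (X ^ (p + q) - coxA (p - 1) * coxA (q - 1)) := by
  have hrefl : reflect (p + q) ((X : ℤ[X]) ^ (p + q)) = 1 := by simp [revAt_le]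
  rw [coxA_pred hp, coxA_pred hq, reflect_sub, hrefl,
    reflect_mul _ _ (natDegree_geom_le p) (natDegree_geom_le q), reflect_geom, reflect_geom,
    coxPoly_starAdj_eq_geom hp hq hr]
  simp only [pow_add, X_pow_eq_geom p, X_pow_eq_geom q, X_pow_eq_geom r, geom_succ]
  ring
end

section
/- Let T be the join of trees T⁽¹⁾,…,T⁽ᵏ⁾ (k ≥ 2) at chosen vertices v_1,…,v_k, and suppose z ∈ ℂ is a root of cox_{T⁽ⁱ⁾} with multiplicity m_i for each i. Setting m = m_1 + ⋯ + m_k, the number z is a root of cox_T with multiplicity at least min{m − m_i : i = 1,…,k}. -/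
open Matrix Polynomial

/-- The Coxeter polynomial of the subgraph of `G` induced on a finset `s`
of vertices. -/
noncomputable def coxOf {V : Type} [Fintype V] [LinearOrder V]
    (G : SimpleGraph V) [DecidableRel G.Adj] (s : Finset V) : Polynomial ℤ :=
  coxPoly (Matrix.of fun i j : {x // x ∈ s} => if G.Adj i.1 j.1 then (1 : ℤ) else 0)

/-- Deleting the vertex `v` splits `M` into diagonal blocks. Any common divisor of the products of
all but one of the block determinants divides `M.det`. -/
theorem Matrix.dvd_det_of_forall_dvd_prod_erase {R V ι : Type*} [CommRing R] [Fintype V]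
    [DecidableEq V] [Fintype ι] [LinearOrder ι] (M : Matrix V V R) (v : V) (c : V → ι)
    (hM : ∀ a b, a ≠ v → b ≠ v → c a ≠ c b → M a b = 0) (d : R)
    (hd : ∀ i, d ∣ ∏ j ∈ Finset.univ.erase i,
      (M.submatrix (Subtype.val : {u // u ≠ v ∧ c u = j} → V) Subtype.val).det) :
    d ∣ M.det := by
  rw [Matrix.det_eq_sum_mul_adjugate_row M v]
  refine Finset.dvd_sum fun u _ => Dvd.dvd.mul_left ?_ _
  rw [Matrix.adjugate_apply]
  refine (hd (c u)).trans ?_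
  set N := M.updateRow v (Pi.single u 1) with hN
  let b : V → WithTop ι := fun x => if x = v ∨ c x = c u then ⊤ else (c x : WithTop ι)
  have hb : N.BlockTriangular b := by
    intro x y hxy
    have hy : y ≠ v ∧ c y ≠ c u := by
      by_contra h
      have : b y = ⊤ := if_pos (by tauto)
      exact not_top_lt (this ▸ hxy)
    rcases eq_or_ne x v with rfl | hx
    · rw [hN, Matrix.updateRow_self, Pi.single_eq_of_ne]
      rintro rfl
      exact hy.2 rfl
    · rw [hN, Matrix.updateRow_ne hx]
      refine hM x y hx hy.1 fun hc => ?_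
      simp [b, hx, hy, hc] at hxy
  rw [hb.det_fintype]
  have hblock : ∀ j ∈ Finset.univ.erase (c u),
      (M.submatrix (Subtype.val : {u // u ≠ v ∧ c u = j} → V) Subtype.val).det =
        (N.toSquareBlock b (j : WithTop ι)).det := by
    intro j hj
    have hj : j ≠ c u := Finset.ne_of_mem_erase hj
    have hiff : ∀ x, (x ≠ v ∧ c x = j) ↔ b x = (j : WithTop ι) := by
      intro x
      by_cases hx : x = v ∨ c x = c u
      · have : b x = ⊤ := if_pos hx
        rw [this]
        simp only [WithTop.top_ne_coe, iff_false]
        rintro ⟨h1, h2⟩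
        exact hx.elim h1 fun h => hj (h2 ▸ h)
      · have : b x = c x := if_neg hx
        rw [this, WithTop.coe_inj]
        tauto
    rw [← Matrix.det_submatrix_equiv_self (Equiv.subtypeEquivRight hiff)]
    congr 1
    ext x y
    simp [Matrix.toSquareBlock_def, hN, Matrix.updateRow_ne x.2.1]
  have hmap := Finset.prod_map (Finset.univ.erase (c u))
    ⟨((↑) : ι → WithTop ι), WithTop.coe_injective⟩ fun a => (N.toSquareBlock b a).det
  refine ((Finset.prod_congr rfl hblock).trans hmap.symm).dvd.trans ?_
  exact Finset.prod_dvd_prod_of_subset _ _ _ (Finset.subset_univ _)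

/-- The characteristic polynomial of `-(G * Gᵀ⁻¹)` for a matrix `G` of determinant one. -/
theorem Matrix.charpoly_neg_mul_transpose_inv {R V : Type*} [CommRing R] [Fintype V]
    [DecidableEq V] (G : Matrix V V R) (hG : G.det = 1) :
    (-(G * Gᵀ⁻¹)).charpoly = ((X : R[X]) • Gᵀ.map C + G.map C).det := by
  have hunit : IsUnit Gᵀ.det := by simp [hG]
  have h : (-(G * Gᵀ⁻¹)).charmatrix * Gᵀ.map C = (X : R[X]) • Gᵀ.map C + G.map C := by
    have hinv : (G * Gᵀ⁻¹).map (C : R →+* R[X]) * Gᵀ.map C = G.map C := by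
      rw [← Matrix.map_mul, Matrix.mul_assoc, Matrix.nonsing_inv_mul _ hunit, Matrix.mul_one]
    have hneg : (-(G * Gᵀ⁻¹)).charmatrix =
        Matrix.scalar V (X : R[X]) + (G * Gᵀ⁻¹).map (C : R →+* R[X]) := by
      ext1 i j
      rw [Matrix.add_apply, Matrix.map_apply, Matrix.charmatrix_apply, Matrix.neg_apply, map_neg,
        sub_neg_eq_add, Matrix.scalar_apply]
    rw [hneg, Matrix.add_mul, hinv, Matrix.scalar_apply, ← Matrix.smul_eq_diagonal_mul]
  have hdet : (Gᵀ.map (C : R →+* R[X])).det = 1 := by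
    rw [← RingHom.mapMatrix_apply, ← RingHom.map_det, Matrix.det_transpose, hG, map_one]
  rw [← h, Matrix.det_mul, hdet, mul_one, Matrix.charpoly]

/-- The pencil `X Ǧᵀ + Ǧ` of the upper triangular Gram matrix `Ǧ` of a graph. -/
noncomputable def SimpleGraph.coxPencil {V : Type} [LinearOrder V] (G : SimpleGraph V)
    [DecidableRel G.Adj] : Matrix V V ℤ[X] :=
  Matrix.of fun i j =>
    if i = j then X + 1 else if G.Adj i j then (if i < j then -1 else -X) else 0

theorem coxOf_eq_det {V : Type} [Fintype V] [LinearOrder V]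
    (G : SimpleGraph V) [DecidableRel G.Adj] (s : Finset V) :
    coxOf G s =
      (G.coxPencil.submatrix (Subtype.val : {x // x ∈ s} → V) Subtype.val).det := by
  unfold coxOf coxPoly
  rw [Matrix.charpoly_neg_mul_transpose_inv]
  · congr 1
    ext1 i j
    rcases lt_trichotomy i j with h | rfl | h
    · have h' : i.1 < j.1 := h
      by_cases hA : G.Adj i.1 j.1 <;>
        simp [SimpleGraph.coxPencil, h, h.ne, h.ne', h.not_gt, h', h'.ne, hA]
    · simp [SimpleGraph.coxPencil]
    · have h' : j.1 < i.1 := h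
      by_cases hA : G.Adj i.1 j.1 <;>
        simp [SimpleGraph.coxPencil, h, h.ne, h.ne', h.not_gt, h'.ne', h'.not_gt, hA,
          G.adj_comm j.1 i.1]
  · rw [Matrix.det_of_isUpperTriangular]
    · simp
    · intro i j (h : j < i)
      simp [h.ne', h.not_gt]

theorem coxOf_univ_eq_det {V : Type} [Fintype V] [LinearOrder V]
    (G : SimpleGraph V) [DecidableRel G.Adj] :
    coxOf G Finset.univ = G.coxPencil.det := by
  rw [coxOf_eq_det]
  exact Matrix.det_submatrix_equiv_self (Equiv.subtypeUnivEquiv Finset.mem_univ) _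

theorem coxOf_monic {V : Type} [Fintype V] [LinearOrder V]
    (G : SimpleGraph V) [DecidableRel G.Adj] (s : Finset V) : (coxOf G s).Monic :=
  Matrix.charpoly_monic _

namespace SimpleGraph

variable {V : Type*} {G : SimpleGraph V} {v : V}

theorem deleteEdges_incidenceSet_adj {a b : V} :
    (G.deleteEdges (G.incidenceSet v)).Adj a b ↔ G.Adj a b ∧ a ≠ v ∧ b ≠ v := by
  simp only [deleteEdges_adj, incidenceSet, Set.mem_ofPred_eq, mem_edgeSet, Sym2.mem_iff]
  grind

theorem not_reachable_deleteEdges_incidenceSet {a : V} (ha : a ≠ v) :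
    ¬ (G.deleteEdges (G.incidenceSet v)).Reachable a v := by
  rintro ⟨p⟩
  have h := p.reverse
  cases h with
  | nil => exact ha rfl
  | cons h _ => exact (deleteEdges_incidenceSet_adj.1 h).2.1 rfl

theorem Connected.exists_adj_reachable_deleteEdges_incidenceSet (hG : G.Connected) {u : V}
    (hu : u ≠ v) :
    ∃ a, G.Adj v a ∧ (G.deleteEdges (G.incidenceSet v)).Reachable a u := by
  have h := (reachable_iff_reflTransGen v u).1 (hG.preconnected v u)
  induction h with
  | refl => exact absurd rfl hu
  | @tail b c _ hbc ih =>
    rcases eq_or_ne b v with rfl | hb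
    · exact ⟨c, hbc, Reachable.refl c⟩
    · obtain ⟨a, ha, hab⟩ := ih hb
      exact ⟨a, ha, hab.trans (deleteEdges_incidenceSet_adj.2 ⟨hbc, hb, hu⟩).reachable⟩

theorem IsAcyclic.eq_of_reachable_deleteEdges_incidenceSet (hG : G.IsAcyclic) {a b : V}
    (ha : G.Adj v a) (hb : G.Adj v b)
    (hab : (G.deleteEdges (G.incidenceSet v)).Reachable a b) : a = b := by
  by_contra hne
  have hbridge := isBridge_iff.1 (isAcyclic_iff_forall_adj_isBridge.1 hG hb)
  have hva : (G.deleteEdges {s(v, b)}).Adj v a := by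
    simp only [deleteEdges_adj, ha, Set.mem_singleton_iff, true_and]
    rw [Sym2.congr_right]
    exact hne
  refine hbridge (hva.reachable.trans (hab.mono ?_))
  intro x y hxy
  obtain ⟨h, hx, hy⟩ := deleteEdges_incidenceSet_adj.1 hxy
  simp [h, hx, hy]

end SimpleGraph

/- `G` is a tree which is the join of the trees `T⁽¹⁾,…,T⁽ᵏ⁾` at the vertices
`w 1, …, w k`: the new vertex `v` is joined exactly to the vertices `w i`, and
`C i` is the vertex set of `T⁽ⁱ⁾`, the connected component of `w i` in the
forest obtained from `G` by deleting all edges incident to `v`. -/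

/-- If `T` is the join of trees `T⁽¹⁾,…,T⁽ᵏ⁾` (`k ≥ 2`) and `z ∈ ℂ` is a root
of `cox_{T⁽ⁱ⁾}` of multiplicity `mᵢ` for each `i`, then `z` is a root of
`cox_T` of multiplicity at least `min {m − mᵢ : i = 1,…,k}`,
where `m = m₁ + ⋯ + m_k`. -/
theorem coxPoly_join_rootMultiplicity {V : Type} [Fintype V] [LinearOrder V]
    (G : SimpleGraph V) [DecidableRel G.Adj] (hT : G.IsTree)
    (k : ℕ) (hk : 2 ≤ k) (v : V) (w : Fin k → V) (hw : Function.Injective w)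
    (hadj : ∀ u, G.Adj v u ↔ ∃ i, u = w i)
    (C : Fin k → Finset V)
    (hC : ∀ i u, u ∈ C i ↔ (G.deleteEdges (G.incidenceSet v)).Reachable (w i) u)
    (z : ℂ) (m : Fin k → ℕ)
    (hm : ∀ i, ((coxOf G (C i)).map (Int.castRingHom ℂ)).rootMultiplicity z = m i) :
    Finset.univ.inf' (Finset.univ_nonempty_iff.mpr ⟨⟨0, by omega⟩⟩)
        (fun i => (∑ j, m j) - m i) ≤
      ((coxOf G Finset.univ).map (Int.castRingHom ℂ)).rootMultiplicity z := by
  classical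
  have hCv : ∀ {i u}, u ∈ C i → u ≠ v := by
    rintro i u hu rfl
    exact SimpleGraph.not_reachable_deleteEdges_incidenceSet
      ((hadj (w i)).2 ⟨i, rfl⟩).ne' ((hC i u).1 hu)
  have hcover : ∀ u, ∃ i, u ≠ v → u ∈ C i := by
    intro u
    by_cases hu : u = v
    · exact ⟨⟨0, by omega⟩, fun h => absurd hu h⟩
    · obtain ⟨a, ha, hau⟩ :=
        hT.connected.exists_adj_reachable_deleteEdges_incidenceSet hu
      obtain ⟨i, rfl⟩ := (hadj a).1 ha
      exact ⟨i, fun _ => (hC i u).2 hau⟩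
  have huniq : ∀ {i j u}, u ∈ C i → u ∈ C j → i = j := fun {i j u} hi hj =>
    hw (hT.isAcyclic.eq_of_reachable_deleteEdges_incidenceSet ((hadj _).2 ⟨i, rfl⟩)
      ((hadj _).2 ⟨j, rfl⟩) (((hC i u).1 hi).trans ((hC j u).1 hj).symm))
  choose c hc using hcover
  have hmem : ∀ j u, (u ≠ v ∧ c u = j) ↔ u ∈ C j := fun j u =>
    ⟨fun h => h.2 ▸ hc u h.1, fun h => ⟨hCv h, huniq (hc u (hCv h)) h⟩⟩
  rw [Polynomial.le_rootMultiplicity_iff ((coxOf_monic G _).map _).ne_zero, coxOf_univ_eq_det,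
    ← Polynomial.coe_mapRingHom, RingHom.map_det]
  refine Matrix.dvd_det_of_forall_dvd_prod_erase _ v c ?_ _ ?_
  · intro a b ha hb hab
    have hne : a ≠ b := fun h => hab (h ▸ rfl)
    have hnadj : ¬ G.Adj a b := fun h => hab <| huniq (u := b)
      ((hC _ _).2 (((hC _ _).1 (hc a ha)).trans
        (SimpleGraph.deleteEdges_incidenceSet_adj.2 ⟨h, ha, hb⟩).reachable)) (hc b hb)
    simp [SimpleGraph.coxPencil, hne, hnadj]
  · intro i
    have hblock : ∀ j, (X - Polynomial.C z) ^ m j ∣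
        (((Polynomial.mapRingHom (Int.castRingHom ℂ)).mapMatrix G.coxPencil).submatrix
          (Subtype.val : {u // u ≠ v ∧ c u = j} → V) Subtype.val).det := by
      intro j
      have h := Polynomial.pow_rootMultiplicity_dvd
        ((coxOf G (C j)).map (Int.castRingHom ℂ)) z
      rw [hm, coxOf_eq_det, ← Polynomial.coe_mapRingHom, RingHom.map_det,
        ← Matrix.det_submatrix_equiv_self (Equiv.subtypeEquivRight (hmem j))] at h
      exact h
    refine dvd_trans ?_ (Finset.prod_dvd_prod_of_dvd _ _ fun j _ => hblock j)
    rw [Finset.prod_pow_eq_pow_sum]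
    refine pow_dvd_pow _ ((Finset.inf'_le _ (Finset.mem_univ i)).trans ?_)
    rw [← Finset.add_sum_erase _ m (Finset.mem_univ i), Nat.add_sub_cancel_left]
end
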